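/- Let d ≥ 2 and let τ_d := (1/d, …, 1/d) ∈ ℝ^d. If (H,z), with H = (H_A,H_B,H_C) traceless, is a facet normal of C(d,d,d) whose face F(H,z) contains the point (τ_d, τ_d, τ_d), then (H,z) is a trivial facet normal. -/

import Mathlib

open scoped BigOperators

noncomputable section

/-- The reduced density matrix on the first subsystem. -/
def rhoA {a b c : ℕ} (ψ : Fin a × Fin b × Fin c → ℂ) : Matrix (Fin a) (Fin a) ℂ :=
  Matrix.of fun i i' => ∑ j : Fin b, ∑ k : Fin c, ψ (i, j, k) * (starRingEnd ℂ) (ψ (i', j, k))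

/-- The reduced density matrix on the second subsystem. -/
def rhoB {a b c : ℕ} (ψ : Fin a × Fin b × Fin c → ℂ) : Matrix (Fin b) (Fin b) ℂ :=
  Matrix.of fun j j' => ∑ i : Fin a, ∑ k : Fin c, ψ (i, j, k) * (starRingEnd ℂ) (ψ (i, j', k))

/-- The reduced density matrix on the third subsystem. -/
def rhoC {a b c : ℕ} (ψ : Fin a × Fin b × Fin c → ℂ) : Matrix (Fin c) (Fin c) ℂ :=
  Matrix.of fun k k' => ∑ i : Fin a, ∑ j : Fin b, ψ (i, j, k) * (starRingEnd ℂ) (ψ (i, j, k'))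

/-- `lam` is the vector of eigenvalues of `ρ`, listed in nonincreasing order
with multiplicity. -/
def IsSpecDown {n : ℕ} (ρ : Matrix (Fin n) (Fin n) ℂ) (lam : Fin n → ℝ) : Prop :=
  Antitone lam ∧ ∃ (hρ : ρ.IsHermitian) (σ : Equiv.Perm (Fin n)), lam = hρ.eigenvalues ∘ σ

/-- The Kronecker cone `C(a,b,c)`. -/
def KronCone (a b c : ℕ) : Set ((Fin a → ℝ) × (Fin b → ℝ) × (Fin c → ℝ)) :=
  { lam | ∃ ψ : Fin a × Fin b × Fin c → ℂ,
      IsSpecDown (rhoA ψ) lam.1 ∧ IsSpecDown (rhoB ψ) lam.2.1 ∧ IsSpecDown (rhoC ψ) lam.2.2 }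

/-- The pairing `⟨(H,z), λ⟩`. -/
def wtPair {a b c : ℕ} (HA : Fin a → ℝ) (HB : Fin b → ℝ) (HC : Fin c → ℝ) (z : ℝ)
    (lam : (Fin a → ℝ) × (Fin b → ℝ) × (Fin c → ℝ)) : ℝ :=
  (∑ i, HA i * lam.1 i) + (∑ j, HB j * lam.2.1 j) + (∑ k, HC k * lam.2.2 k)
    + z * ∑ i, lam.1 i

/-- `H = (H_A, H_B, H_C)` is traceless. -/
def Traceless {a b c : ℕ} (HA : Fin a → ℝ) (HB : Fin b → ℝ) (HC : Fin c → ℝ) : Prop :=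
  (∑ i, HA i) = 0 ∧ (∑ j, HB j) = 0 ∧ (∑ k, HC k) = 0

/-- `(H, z)` is a facet normal of the Kronecker cone `C(a,b,c)`. -/
def IsFacetNormal (a b c : ℕ) (HA : Fin a → ℝ) (HB : Fin b → ℝ) (HC : Fin c → ℝ)
    (z : ℝ) : Prop :=
  Traceless HA HB HC ∧ ¬(HA = 0 ∧ HB = 0 ∧ HC = 0 ∧ z = 0) ∧
  (∀ lam ∈ KronCone a b c, 0 ≤ wtPair HA HB HC z lam) ∧
  Module.finrank ℝ
    (affineSpan ℝ {lam ∈ KronCone a b c | wtPair HA HB HC z lam = 0}).direction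
    = a + b + c - 3

/-- `(H, z)` is a trivial (Weyl chamber) normal. -/
def IsTrivialNormal {a b c : ℕ} (HA : Fin a → ℝ) (HB : Fin b → ℝ) (HC : Fin c → ℝ)
    (z : ℝ) : Prop :=
  ∃ t : ℝ, 0 < t ∧
    ((∃ i i' : Fin a, i < i' ∧ HA = t • (Pi.single i 1 - Pi.single i' 1) ∧
        HB = 0 ∧ HC = 0 ∧ z = 0) ∨
     (∃ j j' : Fin b, j < j' ∧ HB = t • (Pi.single j 1 - Pi.single j' 1) ∧
        HA = 0 ∧ HC = 0 ∧ z = 0) ∨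
     (∃ k k' : Fin c, k < k' ∧ HC = t • (Pi.single k 1 - Pi.single k' 1) ∧
        HA = 0 ∧ HB = 0 ∧ z = 0))

/-- The subspace of vectors supported on coordinates satisfying `P`. -/
def suppSubmodule {ι : Type*} (P : ι → Prop) : Submodule ℂ (ι → ℂ) where
  carrier := {ψ | ∀ p, ¬ P p → ψ p = 0}
  add_mem' := by
    intro x y hx hy p hp
    simp only [Pi.add_apply, hx p hp, hy p hp, add_zero]
  zero_mem' := by intro p _; rfl
  smul_mem' := by
    intro r x hx p hp
    simp only [Pi.smul_apply, hx p hp, smul_zero]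

/-- The zero-weight space `ℋ₀(H,z)`. -/
def weight0Space {a b c : ℕ} (HA : Fin a → ℝ) (HB : Fin b → ℝ) (HC : Fin c → ℝ)
    (z : ℝ) : Submodule ℂ (Fin a × Fin b × Fin c → ℂ) :=
  suppSubmodule fun p => HA p.1 + HB p.2.1 + HC p.2.2 + z = 0

/-- The negative-weight space `ℋ₋(H,z)`. -/
def weightNegSpace {a b c : ℕ} (HA : Fin a → ℝ) (HB : Fin b → ℝ) (HC : Fin c → ℝ)
    (z : ℝ) : Submodule ℂ (Fin a × Fin b × Fin c → ℂ) :=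
  suppSubmodule fun p => HA p.1 + HB p.2.1 + HC p.2.2 + z < 0

/-- Strictly lower triangular matrices `X` with `X i' i = 0` unless
`i < i'` and `Hv i' < Hv i`. -/
def lowerMod {d : ℕ} (Hv : Fin d → ℝ) : Submodule ℂ (Matrix (Fin d) (Fin d) ℂ) where
  carrier := {X | ∀ i' i, ¬ (i < i' ∧ Hv i' < Hv i) → X i' i = 0}
  add_mem' := by
    intro X Y hX hY i' i h
    simp only [Matrix.add_apply, hX i' i h, hY i' i h, add_zero]
  zero_mem' := by intro i' i h; rfl
  smul_mem' := by
    intro r X hX i' i h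
    simp only [Matrix.smul_apply, hX i' i h, smul_zero]

/-- The nilpotent algebra `𝔫₋(H)`. -/
def nMinusMod {a b c : ℕ} (HA : Fin a → ℝ) (HB : Fin b → ℝ) (HC : Fin c → ℝ) :
    Submodule ℂ (Matrix (Fin a) (Fin a) ℂ × Matrix (Fin b) (Fin b) ℂ ×
      Matrix (Fin c) (Fin c) ℂ) :=
  (lowerMod HA).prod ((lowerMod HB).prod (lowerMod HC))

/-- The infinitesimal action `(X,Y,Z) ↦ (X⊗I⊗I + I⊗Y⊗I + I⊗I⊗Z)ψ`. -/
def act {a b c : ℕ}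
    (t : Matrix (Fin a) (Fin a) ℂ × Matrix (Fin b) (Fin b) ℂ × Matrix (Fin c) (Fin c) ℂ)
    (ψ : Fin a × Fin b × Fin c → ℂ) : Fin a × Fin b × Fin c → ℂ := fun p =>
  (∑ i', t.1 p.1 i' * ψ (i', p.2.1, p.2.2)) +
  (∑ j', t.2.1 p.2.1 j' * ψ (p.1, j', p.2.2)) +
  (∑ k', t.2.2 p.2.2 k' * ψ (p.1, p.2.1, k'))

/-- The action as a linear map in `(X,Y,Z)`. -/
def actL {a b c : ℕ} (ψ : Fin a × Fin b × Fin c → ℂ) :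
    (Matrix (Fin a) (Fin a) ℂ × Matrix (Fin b) (Fin b) ℂ × Matrix (Fin c) (Fin c) ℂ)
      →ₗ[ℂ] (Fin a × Fin b × Fin c → ℂ) where
  toFun t := act t ψ
  map_add' t s := by
    funext p
    simp only [act, Prod.fst_add, Prod.snd_add, Matrix.add_apply, add_mul,
      Finset.sum_add_distrib, Pi.add_apply]
    ring
  map_smul' r t := by
    funext p
    simp only [act, Prod.smul_fst, Prod.smul_snd, Matrix.smul_apply, smul_eq_mul,
      Pi.smul_apply, RingHom.id_apply, Finset.mul_sum, mul_assoc, mul_add]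

/-- The tangent map `T_ψ : 𝔫₋(H) → ℋ₋(H,z)` is a linear isomorphism. -/
def TangentIso {a b c : ℕ} (HA : Fin a → ℝ) (HB : Fin b → ℝ) (HC : Fin c → ℝ)
    (z : ℝ) (ψ : Fin a × Fin b × Fin c → ℂ) : Prop :=
  ∃ h : ∀ t ∈ nMinusMod HA HB HC, actL ψ t ∈ weightNegSpace HA HB HC z,
    Function.Bijective ((actL ψ).restrict h)

/-- The tangent map `T_ψ : 𝔫₋(H) → ℋ₋(H,z)` is surjective. -/
def TangentSurj {a b c : ℕ} (HA : Fin a → ℝ) (HB : Fin b → ℝ) (HC : Fin c → ℝ)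
    (z : ℝ) (ψ : Fin a × Fin b × Fin c → ℂ) : Prop :=
  ∃ h : ∀ t ∈ nMinusMod HA HB HC, actL ψ t ∈ weightNegSpace HA HB HC z,
    Function.Surjective ((actL ψ).restrict h)

/-- `(H,z)` is admissible: the hyperplane `⟨(H,z), ·⟩ = 0` in `V` is spanned by
the weights of zero `(H,z)`-weight. -/
def Admissible {a b c : ℕ} (HA : Fin a → ℝ) (HB : Fin b → ℝ) (HC : Fin c → ℝ)
    (z : ℝ) : Prop :=
  (Submodule.span ℝ
    { w : (Fin a → ℝ) × (Fin b → ℝ) × (Fin c → ℝ) |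
      ∃ i j k, HA i + HB j + HC k + z = 0 ∧
        w = (Pi.single i 1, Pi.single j 1, Pi.single k 1) } : Set _)
  = { lam | (∑ i, lam.1 i) = (∑ j, lam.2.1 j) ∧ (∑ i, lam.1 i) = (∑ k, lam.2.2 k) ∧
        wtPair HA HB HC z lam = 0 }

/-- `(H,z)` is a Ressayre element. -/
def IsRessayre {a b c : ℕ} (HA : Fin a → ℝ) (HB : Fin b → ℝ) (HC : Fin c → ℝ)
    (z : ℝ) : Prop :=
  Traceless HA HB HC ∧ ¬(HA = 0 ∧ HB = 0 ∧ HC = 0 ∧ z = 0) ∧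
  Admissible HA HB HC z ∧
  ∃ ψ ∈ weight0Space HA HB HC z, TangentIso HA HB HC z ψ

/-- `(H_A, H_B)` satisfies the extremal-edge condition. -/
def ExtremalEdge {a b : ℕ} (HA : Fin a → ℝ) (HB : Fin b → ℝ) : Prop :=
  (∑ i, HA i) = 0 ∧ (∑ j, HB j) = 0 ∧ ¬(HA = 0 ∧ HB = 0) ∧
  ∀ (x : Fin a → ℝ) (y : Fin b → ℝ), (∑ i, x i) = 0 → (∑ j, y j) = 0 →
    (∀ i j k l, HA i + HB j = HA k + HB l → x i + y j = x k + y l) →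
    ∃ t : ℝ, x = t • HA ∧ y = t • HB

theorem exists_perm_comp_of_map_eq {ι α : Type*} [Fintype ι] {f g : ι → α}
    (h : Finset.univ.val.map f = Finset.univ.val.map g) : ∃ σ : Equiv.Perm ι, f = g ∘ σ := by
  classical
  have hcard : ∀ c, Fintype.card {i // f i = c} = Fintype.card {i // g i = c} := by
    intro c
    have := congrArg (Multiset.count c) h
    simpa only [Multiset.count_map, Fintype.card_subtype, eq_comm, Finset.card_def,
      Finset.filter_val] using this
  refine ⟨Equiv.ofFiberEquiv fun c => Fintype.equivOfCardEq (hcard c), ?_⟩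
  funext i
  exact (Equiv.ofFiberEquiv_map _ i).symm

theorem isSpecDown_diagonal {n : ℕ} {p : Fin n → ℝ} (hp : Antitone p) :
    IsSpecDown (Matrix.diagonal fun i => (p i : ℂ)) p := by
  have hherm : (Matrix.diagonal fun i => (p i : ℂ)).IsHermitian :=
    Matrix.isHermitian_diagonal_of_self_adjoint _ (by ext i; simp)
  refine ⟨hp, hherm, exists_perm_comp_of_map_eq ?_⟩
  have h := hherm.roots_charpoly_eq_eigenvalues
  have hroots : (Matrix.diagonal fun i => (p i : ℂ)).charpoly.roots =
      Finset.univ.val.map fun i => (p i : ℂ) := by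
    rw [Matrix.charpoly_diagonal,
      ← Polynomial.roots_multiset_prod_X_sub_C (Finset.univ.val.map fun i => (p i : ℂ)),
      Multiset.map_map]
    rfl
  rw [hroots] at h
  have h' := congrArg (Multiset.map Complex.re) h
  simpa [Multiset.map_map, Function.comp_def] using h'

theorem IsSpecDown.sum_eq {n : ℕ} {ρ : Matrix (Fin n) (Fin n) ℂ} {lam : Fin n → ℝ}
    (h : IsSpecDown ρ lam) : ((∑ i, lam i : ℝ) : ℂ) = ρ.trace := by
  obtain ⟨-, hρ, σ, rfl⟩ := h
  rw [hρ.trace_eq_sum_eigenvalues]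
  push_cast
  exact Equiv.sum_comp σ fun i => (hρ.eigenvalues i : ℂ)

theorem trace_rhoA_eq_trace_rhoB {a b c : ℕ} (ψ : Fin a × Fin b × Fin c → ℂ) :
    (rhoA ψ).trace = (rhoB ψ).trace := by
  simp only [Matrix.trace, Matrix.diag_apply, rhoA, rhoB, Matrix.of_apply]
  exact Finset.sum_comm

theorem trace_rhoB_eq_trace_rhoC {a b c : ℕ} (ψ : Fin a × Fin b × Fin c → ℂ) :
    (rhoB ψ).trace = (rhoC ψ).trace := by
  simp only [Matrix.trace, Matrix.diag_apply, rhoB, rhoC, Matrix.of_apply]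
  rw [Finset.sum_comm]
  exact (Finset.sum_congr rfl fun _ _ => Finset.sum_comm).trans Finset.sum_comm

theorem sum_eq_of_mem_kronCone {a b c : ℕ} {lam : (Fin a → ℝ) × (Fin b → ℝ) × (Fin c → ℝ)}
    (h : lam ∈ KronCone a b c) :
    ∑ i, lam.1 i = ∑ j, lam.2.1 j ∧ ∑ i, lam.1 i = ∑ k, lam.2.2 k := by
  obtain ⟨ψ, hA, hB, hC⟩ := h
  have hAB := trace_rhoA_eq_trace_rhoB ψ
  have hBC := trace_rhoB_eq_trace_rhoC ψ
  rw [← hA.sum_eq, ← hB.sum_eq] at hAB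
  rw [← hB.sum_eq, ← hC.sum_eq] at hBC
  exact ⟨Complex.ofReal_injective hAB, Complex.ofReal_injective (hAB.trans hBC)⟩

/-- The state with amplitudes `√f` on the Latin square `i + j + k = 0`. -/
def latinState {d : ℕ} [NeZero d] (f : Fin d → Fin d → Fin d → ℝ) : Fin d × Fin d × Fin d → ℂ :=
  fun p => if p.1 + p.2.1 + p.2.2 = 0 then (Real.sqrt (f p.1 p.2.1 p.2.2) : ℂ) else 0

section LatinState

variable {d : ℕ} [NeZero d] {f : Fin d → Fin d → Fin d → ℝ}

theorem latinState_mul_conj (hf : ∀ i j k, 0 ≤ f i j k) (i j k : Fin d) :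
    latinState f (i, j, k) * (starRingEnd ℂ) (latinState f (i, j, k)) =
      if i + j + k = 0 then (f i j k : ℂ) else 0 := by
  unfold latinState
  split_ifs with h
  · rw [Complex.conj_ofReal, ← Complex.ofReal_mul, Real.mul_self_sqrt (hf i j k)]
  · simp

theorem rhoA_latinState (hf : ∀ i j k, 0 ≤ f i j k) :
    rhoA (latinState f) = Matrix.diagonal fun i => ((∑ j, f i j (-(i + j)) : ℝ) : ℂ) := by
  ext i i'
  rw [rhoA, Matrix.of_apply]
  by_cases h : i = i'
  · subst h
    simp [latinState_mul_conj hf, ← neg_eq_iff_add_eq_zero]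
  · rw [Matrix.diagonal_apply_ne _ h]
    refine Finset.sum_eq_zero fun j _ => Finset.sum_eq_zero fun k _ => ?_
    unfold latinState
    split_ifs with h1 h2
    · exact absurd (add_right_cancel (add_right_cancel (h1.trans h2.symm))) h
    all_goals simp

theorem rhoB_latinState (hf : ∀ i j k, 0 ≤ f i j k) :
    rhoB (latinState f) = Matrix.diagonal fun j => ((∑ i, f i j (-(i + j)) : ℝ) : ℂ) := by
  ext j j'
  rw [rhoB, Matrix.of_apply]
  by_cases h : j = j'
  · subst h
    simp [latinState_mul_conj hf, ← neg_eq_iff_add_eq_zero]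
  · rw [Matrix.diagonal_apply_ne _ h]
    refine Finset.sum_eq_zero fun i _ => Finset.sum_eq_zero fun k _ => ?_
    unfold latinState
    split_ifs with h1 h2
    · exact absurd (add_left_cancel (add_right_cancel (h1.trans h2.symm))) h
    all_goals simp

theorem rhoC_latinState (hf : ∀ i j k, 0 ≤ f i j k) :
    rhoC (latinState f) = Matrix.diagonal fun k => ((∑ i, f i (-(i + k)) k : ℝ) : ℂ) := by
  ext k k'
  rw [rhoC, Matrix.of_apply]
  by_cases h : k = k'
  · subst h
    have : ∀ i j : Fin d, i + j + k = 0 ↔ -(i + k) = j := fun i j => by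
      rw [neg_eq_iff_add_eq_zero, add_right_comm]
    simp [latinState_mul_conj hf, this]
  · rw [Matrix.diagonal_apply_ne _ h]
    refine Finset.sum_eq_zero fun i _ => Finset.sum_eq_zero fun j _ => ?_
    unfold latinState
    split_ifs with h1 h2
    · exact absurd (add_left_cancel (h1.trans h2.symm)) h
    all_goals simp

theorem latinState_mem_kronCone (hf : ∀ i j k, 0 ≤ f i j k) {x y w : Fin d → ℝ}
    (hx : ∀ i, ∑ j, f i j (-(i + j)) = x i) (hy : ∀ j, ∑ i, f i j (-(i + j)) = y j)
    (hw : ∀ k, ∑ i, f i (-(i + k)) k = w k)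
    (hxa : Antitone x) (hya : Antitone y) (hwa : Antitone w) : (x, y, w) ∈ KronCone d d d := by
  refine ⟨latinState f, ?_, ?_, ?_⟩
  · simpa only [rhoA_latinState hf, hx] using isSpecDown_diagonal hxa
  · simpa only [rhoB_latinState hf, hy] using isSpecDown_diagonal hya
  · simpa only [rhoC_latinState hf, hw] using isSpecDown_diagonal hwa

end LatinState

section Marginals

variable {d : ℕ} [NeZero d] {p : Fin d → ℝ}

theorem sum_const_div_card (x : ℝ) : ∑ _j : Fin d, x / d = x := by
  have : (d : ℝ) ≠ 0 := Nat.cast_ne_zero.mpr (NeZero.ne d)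
  simp [mul_div_cancel₀ x this]

theorem sum_neg_add (g : Fin d → ℝ) (j : Fin d) : ∑ i, g (-(i + j)) = ∑ i, g i :=
  Equiv.sum_comp ((Equiv.addRight j).trans (Equiv.neg _)) g

theorem sum_neg_add' (g : Fin d → ℝ) (j : Fin d) : ∑ i, g (-(j + i)) = ∑ i, g i :=
  Equiv.sum_comp ((Equiv.addLeft j).trans (Equiv.neg _)) g

theorem mem_kronCone_fst (hp : Antitone p) (h0 : ∀ i, 0 ≤ p i) :
    (p, (fun _ => ∑ i, p i / d), (fun _ => ∑ i, p i / d)) ∈ KronCone d d d :=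
  latinState_mem_kronCone (f := fun i _ _ => p i / d)
    (fun i _ _ => div_nonneg (h0 i) (Nat.cast_nonneg d)) (fun i => sum_const_div_card (p i))
    (fun _ => rfl) (fun _ => rfl) hp antitone_const antitone_const

theorem mem_kronCone_snd (hp : Antitone p) (h0 : ∀ i, 0 ≤ p i) :
    ((fun _ => ∑ i, p i / d), p, (fun _ => ∑ i, p i / d)) ∈ KronCone d d d :=
  latinState_mem_kronCone (f := fun _ j _ => p j / d)
    (fun _ j _ => div_nonneg (h0 j) (Nat.cast_nonneg d)) (fun _ => rfl)
    (fun j => sum_const_div_card (p j)) (fun k => sum_neg_add (fun i => p i / d) k)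
    antitone_const hp antitone_const

theorem mem_kronCone_trd (hp : Antitone p) (h0 : ∀ i, 0 ≤ p i) :
    ((fun _ => ∑ i, p i / d), (fun _ => ∑ i, p i / d), p) ∈ KronCone d d d :=
  latinState_mem_kronCone (f := fun _ _ k => p k / d)
    (fun _ _ k => div_nonneg (h0 k) (Nat.cast_nonneg d))
    (fun i => sum_neg_add' (fun k => p k / d) i) (fun j => sum_neg_add (fun k => p k / d) j)
    (fun k => sum_const_div_card (p k)) antitone_const antitone_const hp

end Marginals

theorem sum_mul_antitone_nonneg {d : ℕ} {H : Fin d → ℝ} (hsum : ∑ i, H i = 0)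
    (hH : ∀ p : Fin d → ℝ, Antitone p → (∀ i, 0 ≤ p i) → 0 ≤ ∑ i, H i * p i)
    {p : Fin d → ℝ} (hp : Antitone p) : 0 ≤ ∑ i, H i * p i := by
  obtain ⟨m, hm⟩ := (Set.finite_range p).bddBelow
  have h := hH (fun i => p i - m) (fun i j hij => sub_le_sub_right (hp hij) m)
    fun i => sub_nonneg.mpr (hm ⟨i, rfl⟩)
  simpa [mul_sub, Finset.sum_sub_distrib, ← Finset.sum_mul, hsum] using h

/-- A nonzero traceless functional that is nonnegative on the Weyl chamber is positive on some
fundamental weight, and its zeros in the chamber lie on the corresponding wall. -/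
theorem exists_wall {d : ℕ} {H : Fin d → ℝ} (hsum : ∑ i, H i = 0) (hne : H ≠ 0)
    (hH : ∀ p : Fin d → ℝ, Antitone p → 0 ≤ ∑ i, H i * p i) :
    ∃ i i' : Fin d, i < i' ∧
      (∀ p : Fin d → ℝ, Antitone p → ∑ l, H l * p l = 0 → p i = p i') ∧
      ∀ c : ℝ, c • H = Pi.single i 1 - Pi.single i' 1 → 0 < c := by
  obtain ⟨i, hi, hmin⟩ : ∃ i, H i ≠ 0 ∧ ∀ j < i, H j = 0 := by
    obtain ⟨i, hi⟩ := Function.ne_iff.mp hne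
    obtain ⟨m, hm, hm'⟩ := (wellFounded_lt (α := Fin d)).has_min {i | H i ≠ 0} ⟨i, hi⟩
    exact ⟨m, hm, fun j hj => not_not.mp fun h => hm' j h hj⟩
  let q : Fin d → ℝ := fun j => if j ≤ i then 1 else 0
  have hq : Antitone q := by
    intro j k hjk
    dsimp only [q]
    split_ifs with h1 h2
    · rfl
    · exact absurd (hjk.trans h1) h2
    · exact zero_le_one
    · rfl
  have hHq : ∑ j, H j * q j = H i := by
    rw [Finset.sum_eq_single i]
    · simp [q]
    · intro j _ hj
      rcases lt_or_gt_of_ne hj with h | h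
      · simp [hmin j h]
      · simp [q, h.not_ge]
    · simp
  have hpos : 0 < H i := lt_of_le_of_ne (hHq ▸ hH q hq) (Ne.symm hi)
  have hlt : (i : ℕ) + 1 < d := by
    by_contra hcon
    refine hi ?_
    rw [← hHq, ← hsum]
    refine Finset.sum_congr rfl fun j _ => ?_
    have : j ≤ i := Fin.le_def.mpr (by omega)
    simp [q, this]
  refine ⟨i, ⟨i + 1, hlt⟩, Fin.lt_def.mpr (Nat.lt_succ_self _), ?_, ?_⟩
  · intro p hp h0
    set i' : Fin d := ⟨i + 1, hlt⟩
    have hii' : i ≤ i' := Fin.le_def.mpr (Nat.le_succ _)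
    have hanti : Antitone fun j => p j - (p i - p i') * q j := by
      intro j k hjk
      have hjk' := hp hjk
      by_cases hk : k ≤ i
      · simp [q, hk, hjk.trans hk, hjk']
      · by_cases hj : j ≤ i
        · have h1 : i' ≤ k := Fin.le_def.mpr (Nat.succ_le_of_lt (Fin.lt_def.mp (not_le.mp hk)))
          have := hp h1
          have := hp hj
          simp only [q, hj, hk, if_true, if_false]
          linarith
        · simp [q, hk, hj, hjk']
    have h := hH _ hanti
    have hexp : ∑ j, H j * (p j - (p i - p i') * q j) = -((p i - p i') * H i) := by
      rw [← hHq, Finset.mul_sum, ← Finset.sum_neg_distrib, ← zero_add (∑ j, -_), ← h0,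
        ← Finset.sum_add_distrib]
      exact Finset.sum_congr rfl fun j _ => by ring
    rw [hexp] at h
    have := hp hii'
    nlinarith
  · intro c hc
    have := congrFun hc i
    have hne' : i ≠ ⟨i + 1, hlt⟩ := fun h => by simpa using congrArg Fin.val h
    simp only [Pi.smul_apply, smul_eq_mul, Pi.sub_apply, Pi.single_eq_same,
      Pi.single_eq_of_ne hne', sub_zero] at this
    exact pos_of_mul_pos_left (this ▸ one_pos) hpos.le

/-- The linear functional on triples of vectors given by a triple of coefficient vectors. -/
def tripleFunctional {d : ℕ} (x y w : Fin d → ℝ) :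
    Module.Dual ℝ ((Fin d → ℝ) × (Fin d → ℝ) × (Fin d → ℝ)) :=
  (dotProductBilin ℝ ℝ x).coprod ((dotProductBilin ℝ ℝ y).coprod (dotProductBilin ℝ ℝ w))

theorem tripleFunctional_apply {d : ℕ} (x y w : Fin d → ℝ)
    (v : (Fin d → ℝ) × (Fin d → ℝ) × (Fin d → ℝ)) :
    tripleFunctional x y w v = ∑ i, x i * v.1 i + (∑ i, y i * v.2.1 i + ∑ i, w i * v.2.2 i) :=
  rfl

theorem tripleFunctional_injective {d : ℕ} {x y w x' y' w' : Fin d → ℝ}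
    (h : tripleFunctional x y w = tripleFunctional x' y' w') : x = x' ∧ y = y' ∧ w = w' := by
  refine ⟨?_, ?_, ?_⟩ <;> funext i
  · simpa [tripleFunctional_apply, Pi.single_apply] using LinearMap.congr_fun h (Pi.single i 1, 0, 0)
  · simpa [tripleFunctional_apply, Pi.single_apply] using LinearMap.congr_fun h (0, Pi.single i 1, 0)
  · simpa [tripleFunctional_apply, Pi.single_apply] using LinearMap.congr_fun h (0, 0, Pi.single i 1)

theorem exists_eq_combination_of_mem_dualAnnihilator {V ι : Type*} [AddCommGroup V] [Module ℝ V]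
    [FiniteDimensional ℝ V] [Fintype ι] (D : Submodule ℝ V) (f : ι → Module.Dual ℝ V)
    (hli : LinearIndependent ℝ f) (hf : ∀ i, f i ∈ D.dualAnnihilator)
    (hD : Module.finrank ℝ D + Fintype.card ι = Module.finrank ℝ V)
    {g : Module.Dual ℝ V} (hg : g ∈ D.dualAnnihilator) : ∃ c : ι → ℝ, ∑ i, c i • f i = g := by
  have hspan : Submodule.span ℝ (Set.range f) = D.dualAnnihilator := by
    refine Submodule.eq_of_le_of_finrank_eq
      (Submodule.span_le.mpr (Set.range_subset_iff.mpr hf)) ?_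
    have := Subspace.finrank_add_finrank_dualAnnihilator_eq D
    rw [finrank_span_eq_card hli]
    omega
  rw [← hspan] at hg
  exact Submodule.mem_span_range_iff_exists_fun ℝ |>.mp hg

theorem mem_dualAnnihilator_direction {V : Type*} [AddCommGroup V] [Module ℝ V] {S : Set V}
    {g : Module.Dual ℝ V} (hg : ∀ v ∈ S, g v = 0) :
    g ∈ (affineSpan ℝ S).direction.dualAnnihilator := by
  rw [Submodule.mem_dualAnnihilator, direction_affineSpan]
  change vectorSpan ℝ S ≤ LinearMap.ker g
  refine Submodule.span_le.mpr ?_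
  rintro _ ⟨v, hv, w, hw, rfl⟩
  simp [hg v hv, hg w hw]

/-- A functional vanishing on a facet of the Kronecker cone is a multiple of the facet normal,
provided it is traceless. -/
theorem exists_smul_eq_of_vanishes_on_facet {d : ℕ} (hd : 2 ≤ d) {HA HB HC : Fin d → ℝ}
    (hfacet : IsFacetNormal d d d HA HB HC 0) {x y w : Fin d → ℝ} (hT : Traceless x y w)
    (hv : ∀ lam ∈ KronCone d d d, wtPair HA HB HC 0 lam = 0 → tripleFunctional x y w lam = 0) :
    ∃ c : ℝ, c • HA = x ∧ c • HB = y ∧ c • HC = w := by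
  obtain ⟨⟨hA, hB, hC⟩, hne, -, hdim⟩ := hfacet
  have hd0 : (d : ℝ) ≠ 0 := by positivity
  let f : Fin 3 → Module.Dual ℝ ((Fin d → ℝ) × (Fin d → ℝ) × (Fin d → ℝ)) :=
    ![tripleFunctional 1 (-1) 0, tripleFunctional 1 0 (-1), tripleFunctional HA HB HC]
  have hcomb : ∀ c : Fin 3 → ℝ, ∀ x y w : Fin d → ℝ, Traceless x y w →
      ∑ i, c i • f i = tripleFunctional x y w →
      c 0 = 0 ∧ c 1 = 0 ∧ c 2 • HA = x ∧ c 2 • HB = y ∧ c 2 • HC = w := by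
    rintro c x y w ⟨-, hy, hw⟩ hc
    have hsum : ∑ i, c i • f i = tripleFunctional ((c 0 + c 1) • 1 + c 2 • HA)
        (-(c 0) • 1 + c 2 • HB) (-(c 1) • 1 + c 2 • HC) := by
      ext v <;> simp [f, Fin.sum_univ_three, tripleFunctional_apply, Pi.single_apply]
    obtain ⟨h1, h2, h3⟩ := tripleFunctional_injective (hsum.symm.trans hc)
    have h0 : c 0 = 0 := by
      have := congrArg (fun v : Fin d → ℝ => ∑ i, v i) h2
      simpa [Finset.sum_add_distrib, ← Finset.mul_sum, hB, hy, hd0] using this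
    have h0' : c 1 = 0 := by
      have := congrArg (fun v : Fin d → ℝ => ∑ i, v i) h3
      simpa [Finset.sum_add_distrib, ← Finset.mul_sum, hC, hw, hd0] using this
    simp only [h0, h0', add_zero, neg_zero, zero_smul, zero_add] at h1 h2 h3
    exact ⟨h0, h0', h1, h2, h3⟩
  have hli : LinearIndependent ℝ f := by
    rw [Fintype.linearIndependent_iff]
    intro c hc
    obtain ⟨h0, h1, h2, h3, h4⟩ := hcomb c 0 0 0 (by simp [Traceless])
      (hc.trans (by ext v <;> simp [tripleFunctional_apply]))
    have h5 : c 2 = 0 := by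
      by_contra hcon
      simp only [smul_eq_zero, hcon, false_or] at h2 h3 h4
      exact hne ⟨h2, h3, h4, rfl⟩
    intro i
    fin_cases i <;> assumption
  obtain ⟨c, hc⟩ := exists_eq_combination_of_mem_dualAnnihilator
    (affineSpan ℝ {lam ∈ KronCone d d d | wtPair HA HB HC 0 lam = 0}).direction f hli
    (by
      intro i
      refine mem_dualAnnihilator_direction fun lam hlam => ?_
      obtain ⟨hAB, hAC⟩ := sum_eq_of_mem_kronCone hlam.1
      have hz := hlam.2
      rw [wtPair, zero_mul, add_zero, add_assoc] at hz
      fin_cases i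
      · simp [f, tripleFunctional_apply, hAB]
      · simp [f, tripleFunctional_apply, hAC]
      · exact hz)
    (by simp only [hdim, Fintype.card_fin, Module.finrank_prod, Module.finrank_fin_fun]; omega)
    (mem_dualAnnihilator_direction (g := tripleFunctional x y w) fun lam hlam =>
      hv lam hlam.1 hlam.2)
  obtain ⟨-, -, h⟩ := hcomb c x y w hT hc
  exact ⟨c 2, h⟩

theorem sum_single_sub_single {d : ℕ} (i i' : Fin d) :
    ∑ l, (Pi.single i (1 : ℝ) - Pi.single i' 1 : Fin d → ℝ) l = 0 := by
  simp

theorem sum_single_sub_single_mul {d : ℕ} (i i' : Fin d) (p : Fin d → ℝ) :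
    ∑ l, (Pi.single i (1 : ℝ) - Pi.single i' 1 : Fin d → ℝ) l * p l = p i - p i' := by
  simp [sub_mul, Finset.sum_sub_distrib, Pi.single_apply]

theorem eq_inv_smul_and_eq_zero {V : Type*} [AddCommGroup V] [Module ℝ V] {c : ℝ} (hc : 0 < c)
    {x y w u : V} (hx : c • x = u) (hy : c • y = 0) (hw : c • w = 0) :
    x = c⁻¹ • u ∧ y = 0 ∧ w = 0 :=
  ⟨by rw [← hx, inv_smul_smul₀ hc.ne'], (smul_eq_zero.mp hy).resolve_left hc.ne',
    (smul_eq_zero.mp hw).resolve_left hc.ne'⟩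

/-- the only facets of `C(d,d,d)` containing `(τ_d, τ_d, τ_d)` are
the trivial ones. -/
theorem facet_through_origin_is_trivial (d : ℕ) (hd : 2 ≤ d)
    (HA HB HC : Fin d → ℝ) (z : ℝ)
    (hfacet : IsFacetNormal d d d HA HB HC z)
    (hmem : ((fun _ : Fin d => (1 : ℝ) / d), (fun _ : Fin d => (1 : ℝ) / d),
        (fun _ : Fin d => (1 : ℝ) / d)) ∈ KronCone d d d ∧
      wtPair HA HB HC z ((fun _ : Fin d => (1 : ℝ) / d),
        (fun _ : Fin d => (1 : ℝ) / d), (fun _ : Fin d => (1 : ℝ) / d)) = 0) :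
    IsTrivialNormal HA HB HC z := by
  have : NeZero d := ⟨by omega⟩
  have hd0 : (d : ℝ) ≠ 0 := Nat.cast_ne_zero.mpr (NeZero.ne d)
  obtain ⟨hA, hB, hC⟩ := hfacet.1
  obtain rfl : z = 0 := by
    simpa [wtPair, ← Finset.sum_mul, hA, hB, hC, hd0] using hmem.2
  have hnonneg := hfacet.2.2.1
  have hPA : ∀ p : Fin d → ℝ, Antitone p → 0 ≤ ∑ i, HA i * p i := fun p hp =>
    sum_mul_antitone_nonneg hA (fun p hp h0 => by
      simpa [wtPair, ← Finset.sum_mul, hB, hC] using hnonneg _ (mem_kronCone_fst hp h0)) hp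
  have hPB : ∀ p : Fin d → ℝ, Antitone p → 0 ≤ ∑ i, HB i * p i := fun p hp =>
    sum_mul_antitone_nonneg hB (fun p hp h0 => by
      simpa [wtPair, ← Finset.sum_mul, hA, hC] using hnonneg _ (mem_kronCone_snd hp h0)) hp
  have hPC : ∀ p : Fin d → ℝ, Antitone p → 0 ≤ ∑ i, HC i * p i := fun p hp =>
    sum_mul_antitone_nonneg hC (fun p hp h0 => by
      simpa [wtPair, ← Finset.sum_mul, hA, hB] using hnonneg _ (mem_kronCone_trd hp h0)) hp
  have hzero : ∀ lam ∈ KronCone d d d, wtPair HA HB HC 0 lam = 0 →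
      (Antitone lam.1 ∧ ∑ i, HA i * lam.1 i = 0) ∧
      (Antitone lam.2.1 ∧ ∑ i, HB i * lam.2.1 i = 0) ∧
      (Antitone lam.2.2 ∧ ∑ i, HC i * lam.2.2 i = 0) := by
    rintro lam ⟨ψ, h1, h2, h3⟩ h
    have k1 := hPA _ h1.1
    have k2 := hPB _ h2.1
    have k3 := hPC _ h3.1
    rw [wtPair] at h
    exact ⟨⟨h1.1, by linarith⟩, ⟨h2.1, by linarith⟩, ⟨h3.1, by linarith⟩⟩
  by_cases hA0 : HA = 0
  · by_cases hB0 : HB = 0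
    · by_cases hC0 : HC = 0
      · exact absurd ⟨hA0, hB0, hC0, rfl⟩ hfacet.2.1
      · obtain ⟨i, i', hlt, hwall, hpos⟩ := exists_wall hC hC0 hPC
        obtain ⟨c, h1, h2, h3⟩ := exists_smul_eq_of_vanishes_on_facet hd hfacet
          (x := 0) (y := 0) (w := Pi.single i 1 - Pi.single i' 1)
          ⟨by simp, by simp, sum_single_sub_single i i'⟩ (fun lam hlam h => by
            obtain ⟨-, -, hanti, h0⟩ := hzero lam hlam h
            simp only [tripleFunctional_apply, sum_single_sub_single_mul, hwall _ hanti h0]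
            simp)
        obtain ⟨e1, e2, e3⟩ := eq_inv_smul_and_eq_zero (hpos c h3) h3 h1 h2
        exact ⟨c⁻¹, inv_pos.mpr (hpos c h3), .inr (.inr ⟨i, i', hlt, e1, e2, e3, rfl⟩)⟩
    · obtain ⟨i, i', hlt, hwall, hpos⟩ := exists_wall hB hB0 hPB
      obtain ⟨c, h1, h2, h3⟩ := exists_smul_eq_of_vanishes_on_facet hd hfacet
        (x := 0) (y := Pi.single i 1 - Pi.single i' 1) (w := 0)
        ⟨by simp, sum_single_sub_single i i', by simp⟩ (fun lam hlam h => by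
          obtain ⟨-, ⟨hanti, h0⟩, -⟩ := hzero lam hlam h
          simp only [tripleFunctional_apply, sum_single_sub_single_mul, hwall _ hanti h0]
          simp)
      obtain ⟨e1, e2, e3⟩ := eq_inv_smul_and_eq_zero (hpos c h2) h2 h1 h3
      exact ⟨c⁻¹, inv_pos.mpr (hpos c h2), .inr (.inl ⟨i, i', hlt, e1, e2, e3, rfl⟩)⟩
  · obtain ⟨i, i', hlt, hwall, hpos⟩ := exists_wall hA hA0 hPA
    obtain ⟨c, h1, h2, h3⟩ := exists_smul_eq_of_vanishes_on_facet hd hfacet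
      (x := Pi.single i 1 - Pi.single i' 1) (y := 0) (w := 0)
      ⟨sum_single_sub_single i i', by simp, by simp⟩ (fun lam hlam h => by
        obtain ⟨⟨hanti, h0⟩, -⟩ := hzero lam hlam h
        simp only [tripleFunctional_apply, sum_single_sub_single_mul, hwall _ hanti h0]
        simp)
    obtain ⟨e1, e2, e3⟩ := eq_inv_smul_and_eq_zero (hpos c h1) h1 h2 h3
    exact ⟨c⁻¹, inv_pos.mpr (hpos c h1), .inl ⟨i, i', hlt, e1, e2, e3, rfl⟩⟩

end
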